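/- arXiv:1709.05317 — 4 statements merged into one kernel-verified Lean document; each statement's English description precedes it below -/
import Mathlib

section
/- Rellich inequality in dimension 3: there exists a constant C > 0 such that for every smooth function u : ℝ³ → ℂ with compact support contained in ℝ³ \ {0} one has ∫_{ℝ³} |u(x)|²/|x|⁴ dx ≤ C ∫_{ℝ³} |Δu(x)|² dx. -/
open MeasureTheory

/-- The Laplacian of a function `u : ℝ³ → ℂ`, as the sum of the second partial
derivatives in the coordinate directions. -/
noncomputable def laplacian3 (u : EuclideanSpace ℝ (Fin 3) → ℂ)
    (x : EuclideanSpace ℝ (Fin 3)) : ℂ :=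
  ∑ j : Fin 3,
    fderiv ℝ (fun y => fderiv ℝ u y (EuclideanSpace.single j 1)) x (EuclideanSpace.single j 1)

namespace RellichAux

abbrev E3 := EuclideanSpace ℝ (Fin 3)

/-- standard basis vector -/
noncomputable abbrev e (j : Fin 3) : E3 := EuclideanSpace.single j 1

/-- partial derivative -/
noncomputable def D {F : Type*} [NormedAddCommGroup F] [NormedSpace ℝ F] (j : Fin 3)
    (u : E3 → F) : E3 → F := fun y => fderiv ℝ u y (e j)

lemma D_smooth {F : Type*} [NormedAddCommGroup F] [NormedSpace ℝ F] (j : Fin 3) {u : E3 → F}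
    (hu : ContDiff ℝ (⊤ : ℕ∞) u) : ContDiff ℝ (⊤ : ℕ∞) (D j u) := by
  unfold D
  exact (hu.fderiv_right (m := (⊤ : ℕ∞)) (by simp)).clm_apply contDiff_const

lemma D_compact {F : Type*} [NormedAddCommGroup F] [NormedSpace ℝ F] (j : Fin 3) {u : E3 → F}
    (hu : HasCompactSupport u) : HasCompactSupport (D j u) :=
  hu.fderiv_apply ℝ (e j)

lemma D_tsupport {F : Type*} [NormedAddCommGroup F] [NormedSpace ℝ F] (j : Fin 3) (u : E3 → F) :
    tsupport (D j u) ⊆ tsupport u :=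
  tsupport_fderiv_apply_subset ℝ (e j)

lemma D_comm (i j : Fin 3) {u : E3 → ℂ} (hu : ContDiff ℝ (⊤ : ℕ∞) u) (x : E3) :
    D i (D j u) x = D j (D i u) x := by
  have hd : DifferentiableAt ℝ (fderiv ℝ u) x :=
    ((hu.fderiv_right (m := (⊤ : ℕ∞)) (by simp)).differentiable (by simp)) x
  have key : ∀ a b : Fin 3, D a (D b u) x = fderiv ℝ (fderiv ℝ u) x (e a) (e b) := by
    intro a b
    unfold D
    rw [fderiv_clm_apply hd (by fun_prop)]
    simp
  rw [key, key]
  have hs : IsSymmSndFDerivAt ℝ u x := hu.contDiffAt.isSymmSndFDerivAt (by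
    simpa using (by exact_mod_cast le_top : ((2 : ℕ∞) : WithTop ℕ∞) ≤ ((⊤ : ℕ∞) : WithTop ℕ∞)))
  exact hs _ _

lemma integrable_D {f : E3 → ℝ} (j : Fin 3) (hf : ContDiff ℝ (⊤ : ℕ∞) f)
    (hc : HasCompactSupport f) : Integrable (D j f) :=
  (D_smooth j hf).continuous.integrable_of_hasCompactSupport (D_compact j hc)

lemma integral_D {f : E3 → ℝ} (j : Fin 3) (hf : ContDiff ℝ (⊤ : ℕ∞) f)
    (hc : HasCompactSupport f) : ∫ x, D j f x = 0 := by
  have h := integral_mul_fderiv_eq_neg_fderiv_mul_of_integrable (μ := (volume : Measure E3))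
    (f := fun _ => (1 : ℝ)) (g := f) (v := e j) (by simp)
    (by simp only [one_mul]; exact integrable_D j hf hc)
    (by simpa using hf.continuous.integrable_of_hasCompactSupport hc)
    (by fun_prop) (fun x _ => hf.differentiable (by simp) x)
  simpa [D] using h

lemma D_inner (j : Fin 3) {f g : E3 → ℂ} (hf : ContDiff ℝ (⊤ : ℕ∞) f)
    (hg : ContDiff ℝ (⊤ : ℕ∞) g) (x : E3) :
    D j (fun y => inner ℝ (f y) (g y)) x = inner ℝ (f x) (D j g x) + inner ℝ (D j f x) (g x) := by
  unfold D
  rw [fderiv_inner_apply ℝ (hf.differentiable (by simp) x) (hg.differentiable (by simp) x)]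

lemma compact_inner {f g : E3 → ℂ} (hf : HasCompactSupport f) :
    HasCompactSupport (fun y => (inner ℝ (f y) (g y) : ℝ)) := by
  refine hf.mono fun x hx => ?_
  rw [Function.mem_support] at hx ⊢
  intro h
  simp [h] at hx

lemma compact_sq {f : E3 → ℂ} (hf : HasCompactSupport f) :
    HasCompactSupport (fun y => ‖f y‖ ^ 2) := by
  simpa using compact_inner (g := f) hf

lemma smooth_sq {f : E3 → ℂ} (hf : ContDiff ℝ (⊤ : ℕ∞) f) :
    ContDiff ℝ (⊤ : ℕ∞) (fun y => ‖f y‖ ^ 2) := hf.norm_sq ℝ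

lemma cross (i j : Fin 3) {u : E3 → ℂ} (hu : ContDiff ℝ (⊤ : ℕ∞) u) (hc : HasCompactSupport u) :
    ∫ x, (inner ℝ (D i (D i u) x) (D j (D j u) x) : ℝ) = ∫ x, ‖D i (D j u) x‖ ^ 2 := by
  have hi := D_smooth i hu
  have hj := D_smooth j hu
  have hjj := D_smooth j hj
  have hij := D_smooth i hj
  have ci := D_compact i hc
  have s1 := hi.inner ℝ hjj
  have s2 := hi.inner ℝ hij
  have c1 : HasCompactSupport (fun y => (inner ℝ (D i u y) (D j (D j u) y) : ℝ)) := compact_inner ci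
  have c2 : HasCompactSupport (fun y => (inner ℝ (D i u y) (D i (D j u) y) : ℝ)) := compact_inner ci
  have h1 := integral_D i s1 c1
  have h2 := integral_D j s2 c2
  have hpt : ∀ x, (inner ℝ (D i (D i u) x) (D j (D j u) x) : ℝ) - ‖D i (D j u) x‖ ^ 2
      = D i (fun y => (inner ℝ (D i u y) (D j (D j u) y) : ℝ)) x
        - D j (fun y => (inner ℝ (D i u y) (D i (D j u) y) : ℝ)) x := by
    intro x
    rw [D_inner i hi hjj, D_inner j hi hij, D_comm j i hj x, D_comm j i hu x,
      real_inner_self_eq_norm_sq]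
    ring
  have i1 : Integrable (fun x => (inner ℝ (D i (D i u) x) (D j (D j u) x) : ℝ)) :=
    ((D_smooth i hi).continuous.inner hjj.continuous).integrable_of_hasCompactSupport
      (compact_inner (D_compact i ci))
  have i2 : Integrable (fun x => ‖D i (D j u) x‖ ^ 2) :=
    (smooth_sq hij).continuous.integrable_of_hasCompactSupport
      (compact_sq (D_compact i (D_compact j hc)))
  have h3 := integral_sub i1 i2
  simp_rw [hpt] at h3
  rw [integral_sub (integrable_D i s1 c1) (integrable_D j s2 c2), h1, h2] at h3
  linarith

lemma lap {u : E3 → ℂ} (hu : ContDiff ℝ (⊤ : ℕ∞) u) (hc : HasCompactSupport u) :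
    ∫ x, ‖laplacian3 u x‖ ^ 2 = ∑ i, ∑ j, ∫ x, ‖D i (D j u) x‖ ^ 2 := by
  have h : ∀ x, ‖laplacian3 u x‖ ^ 2
      = ∑ i, ∑ j, (inner ℝ (D i (D i u) x) (D j (D j u) x) : ℝ) := by
    intro x
    have : laplacian3 u x = ∑ i, D i (D i u) x := rfl
    rw [this, ← real_inner_self_eq_norm_sq, sum_inner]
    simp_rw [inner_sum]
  have hint : ∀ i j, Integrable (fun x => (inner ℝ (D i (D i u) x) (D j (D j u) x) : ℝ)) :=
    fun i j => ((D_smooth i (D_smooth i hu)).continuous.inner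
      (D_smooth j (D_smooth j hu)).continuous).integrable_of_hasCompactSupport
      (compact_inner (D_compact i (D_compact i hc)))
  simp_rw [h]
  rw [integral_finsetSum _ fun i _ => integrable_finsetSum _ fun j _ => hint i j]
  refine Finset.sum_congr rfl fun i _ => ?_
  rw [integral_finsetSum _ fun j _ => hint i j]
  exact Finset.sum_congr rfl fun j _ => cross i j hu hc

/-- weights -/
noncomputable def φ (n : ℕ) (x : E3) : ℝ := ((‖x‖ ^ 2) ^ n)⁻¹

lemma φ_smoothAt (n : ℕ) {x : E3} (hx : x ≠ 0) : ContDiffAt ℝ (⊤ : ℕ∞) (φ n) x := by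
  unfold φ
  refine ContDiffAt.inv ?_ (by positivity)
  exact ((contDiff_norm_sq ℝ).pow n).contDiffAt

lemma weight_compact {g h : E3 → ℝ} (hg : HasCompactSupport g) :
    HasCompactSupport (fun x => h x * g x) := hg.mul_left

lemma weight_smooth (n : ℕ) {g h : E3 → ℝ} (hg : ContDiff ℝ (⊤ : ℕ∞) g)
    (hh : ContDiff ℝ (⊤ : ℕ∞) h) (h0 : (0 : E3) ∉ tsupport g) :
    ContDiff ℝ (⊤ : ℕ∞) (fun x => (h x * φ n x) * g x) := by
  refine contDiff_iff_contDiffAt.mpr fun x => ?_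
  by_cases hx : x ∈ tsupport (fun x => (h x * φ n x) * g x)
  swap
  · exact (contDiffAt_const (c := (0 : ℝ))).congr_of_eventuallyEq
      (notMem_tsupport_iff_eventuallyEq.mp hx)
  have hx2 : x ∈ tsupport g := tsupport_mul_subset_right hx
  have hne : x ≠ 0 := fun h => h0 (h ▸ hx2)
  exact (hh.contDiffAt.mul (φ_smoothAt n hne)).mul hg.contDiffAt

lemma tsupport_sq (f : E3 → ℂ) : tsupport (fun y => ‖f y‖ ^ 2) ⊆ tsupport f := by
  refine closure_mono fun x hx => ?_
  rw [Function.mem_support] at hx ⊢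
  intro h
  simp [h] at hx

lemma D_weight (n : ℕ) (j : Fin 3) {w : E3 → ℂ} (hw : ContDiff ℝ (⊤ : ℕ∞) w) {x : E3}
    (hx : x ≠ 0) :
    D j (fun y => (y j * φ n y) * ‖w y‖ ^ 2) x =
      (φ n x - 2 * n * (x j) ^ 2 * φ (n + 1) x) * ‖w x‖ ^ 2
        + 2 * φ n x * (x j * inner ℝ (w x) (D j w x)) := by
  have hpos : 0 < ‖x‖ ^ 2 := by positivity
  have h1 : HasFDerivAt (fun y : E3 => y j) (EuclideanSpace.proj j : E3 →L[ℝ] ℝ) x :=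
    (EuclideanSpace.proj j : E3 →L[ℝ] ℝ).hasFDerivAt
  have h2 : HasFDerivAt (fun y : E3 => ‖y‖ ^ 2) (2 • (innerSL ℝ x)) x :=
    (hasStrictFDerivAt_norm_sq x).hasFDerivAt
  have h3 := (hasDerivAt_inv (pow_ne_zero n hpos.ne')).comp_hasFDerivAt x (h2.pow n)
  have h4 : HasFDerivAt (fun y => ‖w y‖ ^ 2) _ x :=
    ((hw.differentiable (by simp) x).hasFDerivAt).norm_sq
  have h5 := (h1.mul h3).mul h4
  have h6 : D j (fun y => (y j * φ n y) * ‖w y‖ ^ 2) x = fderiv ℝ _ x (e j) :=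
    rfl
  rw [h6]
  erw [h5.fderiv]
  have hin : inner ℝ x (e j) = x j := by
    have h := EuclideanSpace.inner_single_right (𝕜 := ℝ) j (1 : ℝ) x
    simpa using h
  rcases n with _ | n
  · simp [φ, D, hin]; ring
  · simp [φ, D, hin]
    field_simp
    ring

lemma pointwise (n : ℕ) (hn : n = 0 ∨ n = 1) {w : E3 → ℂ} (hw : ContDiff ℝ (⊤ : ℕ∞) w)
    (h0 : (0 : E3) ∉ tsupport w) (x : E3) :
    φ (n + 1) x * ‖w x‖ ^ 2 ≤
      2 * (1 - 2 * n) * (∑ j, D j (fun y => (y j * φ (n + 1) y) * ‖w y‖ ^ 2) x)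
        + 4 * ∑ j, φ n x * ‖D j w x‖ ^ 2 := by
  by_cases hx : x = 0
  · subst hx
    have hw0 : w 0 = 0 := image_eq_zero_of_notMem_tsupport h0
    have hz : ∀ j, D j (fun y => (y j * φ (n + 1) y) * ‖w y‖ ^ 2) (0 : E3) = 0 := fun j =>
      image_eq_zero_of_notMem_tsupport fun h =>
        h0 (tsupport_sq w (tsupport_mul_subset_right (D_tsupport j _ h)))
    simp only [hz, hw0]
    simp only [norm_zero, Finset.sum_const_zero]
    have : 0 ≤ ∑ j, φ n (0 : E3) * ‖D j w 0‖ ^ 2 :=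
      Finset.sum_nonneg fun j _ => by unfold φ; positivity
    norm_num
    exact this
  · have hpos : 0 < ‖x‖ ^ 2 := by positivity
    have hq : ‖x‖ ^ 2 = ∑ j, (x j) ^ 2 := by
      rw [EuclideanSpace.norm_sq_eq]; simp
    have e1 : ‖x‖ ^ 2 * φ (n + 1 + 1) x = φ (n + 1) x := by
      unfold φ; field_simp; ring
    have e2 : ‖x‖ ^ 2 * φ (n + 1) x = φ n x := by
      unfold φ; field_simp; ring
    have p1 : 0 < φ (n + 1) x := by unfold φ; positivity
    set S := ∑ j, x j * (inner ℝ (w x) (D j w x) : ℝ) with hS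
    set G := ∑ j, ‖D j w x‖ ^ 2 with hG
    have hdiv : ∑ j, D j (fun y => (y j * φ (n + 1) y) * ‖w y‖ ^ 2) x
        = (1 - 2 * n) * (φ (n + 1) x * ‖w x‖ ^ 2) + 2 * φ (n + 1) x * S := by
      simp_rw [fun j => D_weight (n + 1) j hw hx]
      rw [Finset.sum_add_distrib, ← Finset.sum_mul, ← Finset.mul_sum, Finset.sum_sub_distrib,
        ← Finset.sum_mul, ← Finset.mul_sum, ← hq]
      have : 2 * ((n + 1 : ℕ) : ℝ) * ‖x‖ ^ 2 * φ (n + 1 + 1) x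
          = 2 * ((n + 1 : ℕ) : ℝ) * φ (n + 1) x := by rw [← e1]; ring
      rw [this]
      rw [Finset.sum_const, Finset.card_univ, Fintype.card_fin, nsmul_eq_mul]
      push_cast
      ring
    have hS2 : S ^ 2 ≤ ‖x‖ ^ 2 * (‖w x‖ ^ 2 * G) := by
      calc S ^ 2 ≤ (∑ j, (x j) ^ 2) * ∑ j, (inner ℝ (w x) (D j w x) : ℝ) ^ 2 :=
            Finset.sum_mul_sq_le_sq_mul_sq _ _ _
        _ ≤ ‖x‖ ^ 2 * (‖w x‖ ^ 2 * G) := by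
            rw [← hq, hG, Finset.mul_sum (a := ‖w x‖ ^ 2)]
            refine mul_le_mul_of_nonneg_left (Finset.sum_le_sum fun j _ => ?_) hpos.le
            rw [← mul_pow]
            exact sq_le_sq' (neg_le_of_abs_le (abs_real_inner_le_norm _ _))
              (real_inner_le_norm _ _)
    have hG0 : 0 ≤ G := Finset.sum_nonneg fun j _ => by positivity
    have habs : |4 * S| ≤ ‖w x‖ ^ 2 + 4 * (‖x‖ ^ 2 * G) := by
      apply abs_le_of_sq_le_sq _ (by positivity)
      nlinarith [sq_nonneg (‖w x‖ ^ 2 - 4 * (‖x‖ ^ 2 * G))]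
    rw [hdiv, ← Finset.mul_sum, ← e2]
    obtain ⟨l, r⟩ := abs_le.mp habs
    have hl := mul_le_mul_of_nonneg_left l p1.le
    have hr := mul_le_mul_of_nonneg_left r p1.le
    rcases hn with rfl | rfl
    · push_cast
      nlinarith
    · push_cast
      nlinarith

lemma int_weight (n : ℕ) {w : E3 → ℂ} (hw : ContDiff ℝ (⊤ : ℕ∞) w)
    (hc : HasCompactSupport w) (h0 : (0 : E3) ∉ tsupport w) :
    Integrable (fun x => φ n x * ‖w x‖ ^ 2) := by
  have h := (weight_smooth n (h := fun _ => 1) (smooth_sq hw) contDiff_const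
    fun h => h0 (tsupport_sq w h)).continuous
  simp only [one_mul] at h
  exact h.integrable_of_hasCompactSupport (weight_compact (compact_sq hc))

lemma hardy (n : ℕ) (hn : n = 0 ∨ n = 1) {w : E3 → ℂ} (hw : ContDiff ℝ (⊤ : ℕ∞) w)
    (hc : HasCompactSupport w) (h0 : (0 : E3) ∉ tsupport w) :
    ∫ x, φ (n + 1) x * ‖w x‖ ^ 2 ≤ 4 * ∑ j, ∫ x, φ n x * ‖D j w x‖ ^ 2 := by
  have hs : ∀ j : Fin 3, ContDiff ℝ (⊤ : ℕ∞) (fun y : E3 => (y j * φ (n + 1) y) * ‖w y‖ ^ 2) :=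
    fun j => weight_smooth (n + 1) (h := fun y : E3 => y j) (smooth_sq hw)
      (EuclideanSpace.proj j : E3 →L[ℝ] ℝ).contDiff fun h => h0 (tsupport_sq w h)
  have hcs : ∀ j : Fin 3, HasCompactSupport (fun y : E3 => (y j * φ (n + 1) y) * ‖w y‖ ^ 2) :=
    fun j => weight_compact (compact_sq hc)
  have i1 : Integrable (fun x => 2 * (1 - 2 * (n : ℝ)) *
      ∑ j, D j (fun y => (y j * φ (n + 1) y) * ‖w y‖ ^ 2) x) :=
    (integrable_finsetSum _ fun j _ => integrable_D j (hs j) (hcs j)).const_mul _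
  have i2 : ∀ j, Integrable (fun x => φ n x * ‖D j w x‖ ^ 2) := fun j =>
    int_weight n (D_smooth j hw) (D_compact j hc) fun h => h0 (D_tsupport j w h)
  have i3 : Integrable (fun x => 4 * ∑ j, φ n x * ‖D j w x‖ ^ 2) :=
    (integrable_finsetSum _ fun j _ => i2 j).const_mul _
  have h := integral_mono (int_weight (n + 1) hw hc h0) (i1.add i3)
    (fun x => pointwise n hn hw h0 x)
  simp only [Pi.add_apply] at h
  rw [integral_add i1 i3, integral_const_mul, integral_const_mul,
    integral_finsetSum _ fun j _ => integrable_D j (hs j) (hcs j),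
    integral_finsetSum _ fun j _ => i2 j] at h
  simp_rw [fun j => integral_D j (hs j) (hcs j)] at h
  simpa using h

end RellichAux

open RellichAux in
/-- Rellich inequality in dimension 3: there is `C > 0` such that for every smooth `u : ℝ³ → ℂ`
with compact support contained in `ℝ³ \ {0}`,
`∫ |u x|² / |x|⁴ dx ≤ C ∫ |Δu x|² dx`. -/
theorem rellich_inequality :
    ∃ C : ℝ, 0 < C ∧ ∀ u : EuclideanSpace ℝ (Fin 3) → ℂ,
      ContDiff ℝ (⊤ : ℕ∞) u → HasCompactSupport u → (0 : EuclideanSpace ℝ (Fin 3)) ∉ tsupport u →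
      (∫ x : EuclideanSpace ℝ (Fin 3), ‖u x‖ ^ 2 / ‖x‖ ^ 4) ≤
        C * ∫ x : EuclideanSpace ℝ (Fin 3), ‖laplacian3 u x‖ ^ 2 := by
  refine ⟨16, by norm_num, fun u hu hc h0 => ?_⟩
  have e1 : (fun x : E3 => ‖u x‖ ^ 2 / ‖x‖ ^ 4) = fun x => φ (1 + 1) x * ‖u x‖ ^ 2 := by
    funext x
    unfold φ
    rw [← pow_mul, div_eq_inv_mul]
  rw [e1, lap hu hc, Finset.sum_comm]
  have h1 := hardy 1 (Or.inr rfl) hu hc h0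
  have h2 : ∀ j, ∫ x, φ 1 x * ‖D j u x‖ ^ 2 ≤ 4 * ∑ i, ∫ x, ‖D i (D j u) x‖ ^ 2 := by
    intro j
    have h := hardy 0 (Or.inl rfl) (D_smooth j hu) (D_compact j hc)
      fun h => h0 (D_tsupport j u h)
    simpa [φ] using h
  have h3 := Finset.sum_le_sum fun j (_ : j ∈ Finset.univ) => h2 j
  rw [← Finset.mul_sum] at h3
  linarith
end

section
/- There exists a constant C > 0 such that for every smooth function u : ℝ³ → ℂ with compact support contained in ℝ³ \ {0} one has ‖u/|x|‖_{H¹} ≤ C ‖u‖_{H²}, i.e. ∫ |u(x)|²/|x|² dx + ∫ |∇(u/|x|)(x)|² dx ≤ C² ( ∫|u|² + ∫|∇u|² + ∫|D²u|² ). -/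
open MeasureTheory

/-- Weighted Hardy: regularity of a function supported away from the origin times a weight. -/
lemma cb_contDiff {f : EuclideanSpace ℝ (Fin 3) → ℝ} (k : ℕ) (hf : ContDiff ℝ 1 f)
    (h0 : (0 : EuclideanSpace ℝ (Fin 3)) ∉ tsupport f) :
    ContDiff ℝ 1 (fun x => f x * ((‖x‖ ^ 2) ^ k)⁻¹) := by
  rw [contDiff_iff_contDiffAt]
  intro x
  by_cases hx : x ∈ tsupport (fun x => f x * ((‖x‖ ^ 2) ^ k)⁻¹)
  swap
  · exact contDiffAt_const.congr_of_eventuallyEq (notMem_tsupport_iff_eventuallyEq.mp hx)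
  have hx' : x ∈ tsupport f := tsupport_mul_subset_left hx
  have hx0 : x ≠ 0 := fun h => h0 (h ▸ hx')
  have : (‖x‖ ^ 2) ^ k ≠ 0 := by positivity
  exact hf.contDiffAt.mul ((((contDiff_norm_sq ℝ).pow k).contDiffAt).inv this)

lemma cb_integrable {f : EuclideanSpace ℝ (Fin 3) → ℝ} (k : ℕ) (hf : Continuous f)
    (hc : HasCompactSupport f) (h0 : (0 : EuclideanSpace ℝ (Fin 3)) ∉ tsupport f) :
    Integrable (fun x => f x * ((‖x‖ ^ 2) ^ k)⁻¹) := by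
  apply Continuous.integrable_of_hasCompactSupport
  · apply continuous_of_tsupport
    intro x hx
    have hx' : x ∈ tsupport f := tsupport_mul_subset_left hx
    have hx0 : x ≠ 0 := fun h => h0 (h ▸ hx')
    have : (‖x‖ ^ 2) ^ k ≠ 0 := by positivity
    exact hf.continuousAt.mul (ContinuousAt.inv₀ (by fun_prop) this)
  · exact hc.mul_right

lemma cb_ibp {f : EuclideanSpace ℝ (Fin 3) → ℝ} (hf : ContDiff ℝ 1 f)
    (hc : HasCompactSupport f) :
    Integrable (fun x => fderiv ℝ f x x) ∧
    ∫ x, fderiv ℝ f x x = - (3 * ∫ x, f x) := by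
  have hfd : Continuous (fderiv ℝ f) := hf.continuous_fderiv (by simp)
  have hdec : ∀ x : EuclideanSpace ℝ (Fin 3), fderiv ℝ f x x =
      ∑ i, fderiv ℝ f x (EuclideanSpace.single i 1) * x i := by
    intro x
    have hx : x = ∑ i, x i • EuclideanSpace.single i (1:ℝ) := by
      ext j
      simp [Finset.sum_apply, Pi.single_apply]
    conv_lhs => arg 2; rw [hx]
    rw [map_sum]
    simp [mul_comm]
  have hint : ∀ i, Integrable
      (fun x : EuclideanSpace ℝ (Fin 3) => fderiv ℝ f x (EuclideanSpace.single i 1) * x i) := by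
    intro i
    apply Continuous.integrable_of_hasCompactSupport (by fun_prop)
    exact (hc.fderiv_apply ℝ _).mul_right
  have hi : ∀ i, ∫ x : EuclideanSpace ℝ (Fin 3),
      fderiv ℝ f x (EuclideanSpace.single i 1) * x i = - ∫ x, f x := by
    intro i
    have hd : ∀ x : EuclideanSpace ℝ (Fin 3), HasFDerivAt (fun x : EuclideanSpace ℝ (Fin 3) => x i)
        (EuclideanSpace.proj i : EuclideanSpace ℝ (Fin 3) →L[ℝ] ℝ) x :=
      fun x => (EuclideanSpace.proj i : EuclideanSpace ℝ (Fin 3) →L[ℝ] ℝ).hasFDerivAt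
    have hd1 : ∀ x : EuclideanSpace ℝ (Fin 3), fderiv ℝ (fun x : EuclideanSpace ℝ (Fin 3) => x i) x
        (EuclideanSpace.single i 1) = 1 := by
      intro x; rw [(hd x).fderiv]; simp
    have := integral_mul_fderiv_eq_neg_fderiv_mul_of_integrable (μ := volume) (f := f)
      (g := fun x : EuclideanSpace ℝ (Fin 3) => x i)
      (v := EuclideanSpace.single i 1) (hint i)
      (by simp only [hd1, mul_one]; exact hf.continuous.integrable_of_hasCompactSupport hc)
      (by
        apply Continuous.integrable_of_hasCompactSupport
        · have := hf.continuous; fun_prop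
        · exact hc.mul_right)
      (fun x _ => (hf.differentiable (by simp)).differentiableAt)
      (fun x _ => (hd x).differentiableAt)
    simp only [hd1, mul_one] at this
    linarith
  simp only [hdec]
  refine ⟨integrable_finsetSum _ fun i _ => hint i, ?_⟩
  rw [integral_finsetSum _ fun i _ => hint i]
  simp [hi]

lemma cb_hardy {v : EuclideanSpace ℝ (Fin 3) → ℂ} (k : ℕ) (hk : |(3 : ℝ) - 2 * (k + 1 : ℕ)| = 1)
    (hv : ContDiff ℝ 1 v) (hc : HasCompactSupport v)
    (h0 : (0 : EuclideanSpace ℝ (Fin 3)) ∉ tsupport v) :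
    ∫ x, ‖v x‖ ^ 2 * ((‖x‖ ^ 2) ^ (k + 1))⁻¹ ≤
      4 * ∫ x, ‖fderiv ℝ v x‖ ^ 2 * ((‖x‖ ^ 2) ^ k)⁻¹ := by
  set F : EuclideanSpace ℝ (Fin 3) → ℝ := fun x => ‖v x‖ ^ 2 * ((‖x‖ ^ 2) ^ (k + 1))⁻¹ with hF
  set G : EuclideanSpace ℝ (Fin 3) → ℝ := fun x => ‖fderiv ℝ v x‖ ^ 2 * ((‖x‖ ^ 2) ^ k)⁻¹ with hG
  have hts : tsupport (fun x => ‖v x‖ ^ 2) ⊆ tsupport v :=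
    tsupport_comp_subset (g := fun z : ℂ => ‖z‖ ^ 2) (by simp) v
  have hts' : tsupport (fun x => ‖fderiv ℝ v x‖ ^ 2) ⊆ tsupport v :=
    (tsupport_comp_subset (g := fun z : EuclideanSpace ℝ (Fin 3) →L[ℝ] ℂ => ‖z‖ ^ 2) (by simp)
      (fderiv ℝ v)).trans (tsupport_fderiv_subset ℝ)
  have hc1 : HasCompactSupport (fun x => ‖v x‖ ^ 2) :=
    hc.of_isClosed_subset (isClosed_tsupport _) hts
  have hc2 : HasCompactSupport (fun x => ‖fderiv ℝ v x‖ ^ 2) :=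
    hc.of_isClosed_subset (isClosed_tsupport _) hts'
  have hfd : Continuous (fderiv ℝ v) := hv.continuous_fderiv (by simp)
  have hFi : Integrable F := cb_integrable (k+1) (by have := hv.continuous; fun_prop) hc1
    (fun h => h0 (hts h))
  have hGi : Integrable G := cb_integrable k (by fun_prop) hc2 (fun h => h0 (hts' h))
  have hFd : ContDiff ℝ 1 F := cb_contDiff (k+1) (hv.norm_sq ℝ) (fun h => h0 (hts h))
  have hFc : HasCompactSupport F := hc1.mul_right
  obtain ⟨hi, he⟩ := cb_ibp hFd hFc
  have hne : ∀ᵐ x : EuclideanSpace ℝ (Fin 3), x ≠ 0 := by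
    simp [ae_iff]
  have key : ∀ᵐ x : EuclideanSpace ℝ (Fin 3),
      |fderiv ℝ F x x + 2 * (k + 1 : ℕ) * F x| ≤ (1/2) * F x + 2 * G x := by
    filter_upwards [hne] with x hx
    have hxn : ‖x‖ ≠ 0 := by simpa using hx
    have hp : 0 < ‖x‖ := by positivity
    have h1 := ((hv.differentiable (by simp)) x).hasFDerivAt.norm_sq
    have h2 := (hasStrictFDerivAt_norm_sq x).hasFDerivAt
    have h3 := (hasDerivAt_pow (k+1) (‖x‖^2)).comp_hasFDerivAt x h2
    have h4 := (hasDerivAt_inv (x := (‖x‖^2)^(k+1)) (by positivity)).comp_hasFDerivAt x h3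
    have h5 := h1.mul h4
    have h6 : fderiv ℝ F x x + 2 * (k + 1 : ℕ) * F x =
        2 * inner ℝ (v x) (fderiv ℝ v x x) * ((‖x‖ ^ 2) ^ (k + 1))⁻¹ := by
      have : fderiv ℝ F x = _ := HasFDerivAt.fderiv h5
      rw [this, hF]
      simp
      field_simp
      ring
    rw [h6]
    have h7 : |inner ℝ (v x) (fderiv ℝ v x x)| ≤ ‖v x‖ * (‖fderiv ℝ v x‖ * ‖x‖) :=
      (abs_real_inner_le_norm _ _).trans
        (mul_le_mul_of_nonneg_left ((fderiv ℝ v x).le_opNorm x) (norm_nonneg _))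
    rw [abs_mul, abs_mul, abs_of_pos (show (0:ℝ) < ((‖x‖ ^ 2) ^ (k + 1))⁻¹ by positivity), abs_two]
    have h8 : G x = (‖fderiv ℝ v x‖ * ‖x‖) ^ 2 * ((‖x‖ ^ 2) ^ (k + 1))⁻¹ := by
      rw [hG]; simp only []; field_simp; ring
    rw [h8, hF]
    simp only []
    have h9 : 2 * |inner ℝ (v x) (fderiv ℝ v x x)| ≤
        1/2 * ‖v x‖ ^ 2 + 2 * (‖fderiv ℝ v x‖ * ‖x‖) ^ 2 := by
      nlinarith [sq_nonneg (‖v x‖ - 2 * (‖fderiv ℝ v x‖ * ‖x‖))]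
    calc _ ≤ (1/2 * ‖v x‖ ^ 2 + 2 * (‖fderiv ℝ v x‖ * ‖x‖) ^ 2) * ((‖x‖ ^ 2) ^ (k + 1))⁻¹ :=
          mul_le_mul_of_nonneg_right h9 (by positivity)
      _ = _ := by ring
  have hIF : Integrable (fun x => fderiv ℝ F x x + 2 * (k + 1 : ℕ) * F x) :=
    hi.add (hFi.const_mul _)
  have h10 : ∫ x, (fderiv ℝ F x x + 2 * (k + 1 : ℕ) * F x) = -((3 - 2 * (k + 1 : ℕ)) * ∫ x, F x) := by
    rw [integral_add hi (hFi.const_mul _), he, integral_const_mul]; ring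
  have h11 : |∫ x, (fderiv ℝ F x x + 2 * (k + 1 : ℕ) * F x)| ≤ (1/2) * (∫ x, F x) + 2 * ∫ x, G x := by
    calc _ ≤ ∫ x, |fderiv ℝ F x x + 2 * (k + 1 : ℕ) * F x| := abs_integral_le_integral_abs
      _ ≤ ∫ x, ((1/2) * F x + 2 * G x) :=
          integral_mono_ae hIF.abs ((hFi.const_mul _).add (hGi.const_mul _)) key
      _ = _ := by
          rw [integral_add (hFi.const_mul _) (hGi.const_mul _), integral_const_mul,
            integral_const_mul]
  rw [h10, abs_neg, abs_mul, hk, one_mul] at h11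
  have := le_abs_self (∫ x, F x)
  linarith

lemma cb_opnorm (L : EuclideanSpace ℝ (Fin 3) →L[ℝ] ℂ) :
    ‖L‖ ^ 2 ≤ ∑ i, ‖L (EuclideanSpace.single i 1)‖ ^ 2 := by
  set S := ∑ i, ‖L (EuclideanSpace.single i 1)‖ ^ 2 with hS
  have hS0 : 0 ≤ S := by positivity
  have h : ‖L‖ ≤ Real.sqrt S := by
    refine L.opNorm_le_bound (Real.sqrt_nonneg _) fun x => ?_
    have hx : x = ∑ i, x i • EuclideanSpace.single i (1:ℝ) := by
      ext j
      simp [Finset.sum_apply, Pi.single_apply]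
    have h1 : ‖L x‖ ≤ ∑ i, ‖L (EuclideanSpace.single i 1)‖ * ‖x i‖ := by
      conv_lhs => rw [hx, map_sum]
      refine (norm_sum_le _ _).trans (Finset.sum_le_sum fun i _ => ?_)
      rw [map_smul, norm_smul, mul_comm]
    refine h1.trans ?_
    rw [EuclideanSpace.norm_eq]
    exact Real.sum_mul_le_sqrt_mul_sqrt _ _ _
  calc ‖L‖ ^ 2 ≤ Real.sqrt S ^ 2 := by gcongr
    _ = S := Real.sq_sqrt hS0

lemma cb_hess {u : EuclideanSpace ℝ (Fin 3) → ℂ} (hu : ContDiff ℝ 2 u)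
    (x : EuclideanSpace ℝ (Fin 3)) (i : Fin 3) :
    ‖fderiv ℝ (fun y => fderiv ℝ u y (EuclideanSpace.single i 1)) x‖ ≤ ‖iteratedFDeriv ℝ 2 u x‖ := by
  refine ContinuousLinearMap.opNorm_le_bound _ (norm_nonneg _) fun w => ?_
  have hd : DifferentiableAt ℝ (fderiv ℝ u) x :=
    (hu.fderiv_right (m := 1) (by norm_num)).differentiable (by simp) x
  have h : fderiv ℝ (fun y => fderiv ℝ u y (EuclideanSpace.single i 1)) x w =
      iteratedFDeriv ℝ 2 u x ![w, EuclideanSpace.single i 1] := by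
    rw [iteratedFDeriv_two_apply, fderiv_clm_apply hd (by simp)]
    simp
  rw [h]
  refine ((iteratedFDeriv ℝ 2 u x).le_opNorm _).trans ?_
  simp [Fin.prod_univ_two]

lemma cb_quot {u : EuclideanSpace ℝ (Fin 3) → ℂ} (hu : ContDiff ℝ 1 u)
    {x : EuclideanSpace ℝ (Fin 3)} (hx : x ≠ 0) :
    ‖fderiv ℝ (fun y => u y / (‖y‖ : ℂ)) x‖ ^ 2 ≤
      2 * (‖fderiv ℝ u x‖ ^ 2 * ((‖x‖ ^ 2) ^ 1)⁻¹) + 2 * (‖u x‖ ^ 2 * ((‖x‖ ^ 2) ^ 2)⁻¹) := by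
  have hp : 0 < ‖x‖ := by positivity
  have hn : DifferentiableAt ℝ (fun y : EuclideanSpace ℝ (Fin 3) => ‖y‖) x :=
    (contDiffAt_norm ℝ hx (n := 1)).differentiableAt (by simp)
  have hn1 : ‖fderiv ℝ (fun y : EuclideanSpace ℝ (Fin 3) => ‖y‖) x‖ ≤ 1 := by
    simpa using norm_fderiv_le_of_lipschitz ℝ
      (lipschitzWith_one_norm (E := EuclideanSpace ℝ (Fin 3))) (x₀ := x)
  have hi := (hasDerivAt_inv hp.ne').comp_hasFDerivAt x hn.hasFDerivAt
  have hq := hi.smul ((hu.differentiable (by simp)) x).hasFDerivAt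
  have heq : (fun y => u y / (‖y‖ : ℂ)) =
      ((fun y => y⁻¹) ∘ (fun y : EuclideanSpace ℝ (Fin 3) => ‖y‖)) • u := by
    funext y
    simp [div_eq_inv_mul]
  rw [heq, hq.fderiv]
  have hb : ‖((fun y => y⁻¹) ∘ (fun y : EuclideanSpace ℝ (Fin 3) => ‖y‖)) x • fderiv ℝ u x +
      ((-(‖x‖ ^ 2)⁻¹) • fderiv ℝ (fun y : EuclideanSpace ℝ (Fin 3) => ‖y‖) x).smulRight (u x)‖
      ≤ ‖fderiv ℝ u x‖ * ‖x‖⁻¹ + ‖u x‖ * (‖x‖ ^ 2)⁻¹ := by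
    refine (norm_add_le _ _).trans (add_le_add ?_ ?_)
    · rw [norm_smul]; simp [mul_comm]
    · rw [ContinuousLinearMap.norm_smulRight_apply, norm_smul, norm_neg, norm_inv, norm_pow,
        norm_norm]
      have : (‖x‖ ^ 2)⁻¹ * ‖fderiv ℝ (fun y : EuclideanSpace ℝ (Fin 3) => ‖y‖) x‖
        ≤ (‖x‖ ^ 2)⁻¹ * 1 := by gcongr
      nlinarith [norm_nonneg (u x)]
  refine (pow_le_pow_left₀ (norm_nonneg _) hb 2).trans ?_
  have e1 : ‖fderiv ℝ u x‖ ^ 2 * ((‖x‖ ^ 2) ^ 1)⁻¹ = (‖fderiv ℝ u x‖ * ‖x‖⁻¹) ^ 2 := by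
    field_simp
  have e2 : ‖u x‖ ^ 2 * ((‖x‖ ^ 2) ^ 2)⁻¹ = (‖u x‖ * (‖x‖ ^ 2)⁻¹) ^ 2 := by
    field_simp
  rw [e1, e2]
  nlinarith [sq_nonneg (‖fderiv ℝ u x‖ * ‖x‖⁻¹ - ‖u x‖ * (‖x‖ ^ 2)⁻¹)]

/-- There is `C > 0` such that for every smooth `u : ℝ³ → ℂ` with compact support
avoiding the origin, `‖u/|x|‖_{H¹} ≤ C ‖u‖_{H²}`, i.e.
`∫ |u|²/|x|² + ∫ |∇(u/|x|)|² ≤ C² (∫ |u|² + ∫ |∇u|² + ∫ |D²u|²)`. -/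
theorem coulomb_H1_H2_bound :
    ∃ C : ℝ, 0 < C ∧ ∀ u : EuclideanSpace ℝ (Fin 3) → ℂ,
      ContDiff ℝ (⊤ : ℕ∞) u → HasCompactSupport u → (0 : EuclideanSpace ℝ (Fin 3)) ∉ tsupport u →
      (∫ x : EuclideanSpace ℝ (Fin 3), ‖u x‖ ^ 2 / ‖x‖ ^ 2) +
        (∫ x : EuclideanSpace ℝ (Fin 3), ‖fderiv ℝ (fun y => u y / (‖y‖ : ℂ)) x‖ ^ 2) ≤
      C ^ 2 * ((∫ x : EuclideanSpace ℝ (Fin 3), ‖u x‖ ^ 2) +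
        (∫ x : EuclideanSpace ℝ (Fin 3), ‖fderiv ℝ u x‖ ^ 2) +
        (∫ x : EuclideanSpace ℝ (Fin 3), ‖iteratedFDeriv ℝ 2 u x‖ ^ 2)) := by
  refine ⟨11, by norm_num, fun u hu hc h0 => ?_⟩
  have hu2 : ContDiff ℝ 2 u := contDiff_infty.mp hu 2
  have hu1 : ContDiff ℝ 1 u := hu2.of_le (by norm_num)
  have hts : tsupport (fun x => ‖u x‖ ^ 2) ⊆ tsupport u :=
    tsupport_comp_subset (g := fun z : ℂ => ‖z‖ ^ 2) (by simp) u
  have hts' : tsupport (fun x => ‖fderiv ℝ u x‖ ^ 2) ⊆ tsupport u :=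
    (tsupport_comp_subset (g := fun z : EuclideanSpace ℝ (Fin 3) →L[ℝ] ℂ => ‖z‖ ^ 2) (by simp)
      (fderiv ℝ u)).trans (tsupport_fderiv_subset ℝ)
  have hfd : Continuous (fderiv ℝ u) := hu1.continuous_fderiv (by simp)
  have hI4 : Integrable (fun x => ‖u x‖ ^ 2 * ((‖x‖ ^ 2) ^ 2)⁻¹) :=
    cb_integrable 2 (by have := hu.continuous; fun_prop)
      (hc.of_isClosed_subset (isClosed_tsupport _) hts) (fun h => h0 (hts h))
  have hI2 : Integrable (fun x => ‖fderiv ℝ u x‖ ^ 2 * ((‖x‖ ^ 2) ^ 1)⁻¹) :=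
    cb_integrable 1 (by fun_prop)
      (hc.of_isClosed_subset (isClosed_tsupport _) hts') (fun h => h0 (hts' h))
  have A := cb_hardy 0 (by norm_num) hu1 hc h0
  have B := cb_hardy 1 (by norm_num [abs_of_neg]) hu1 hc h0
  have hne : ∀ᵐ x : EuclideanSpace ℝ (Fin 3), x ≠ 0 := by
    simp [ae_iff]
  -- the quotient
  have Q : ∫ x : EuclideanSpace ℝ (Fin 3), ‖fderiv ℝ (fun y => u y / (‖y‖ : ℂ)) x‖ ^ 2 ≤
      2 * (∫ x, ‖fderiv ℝ u x‖ ^ 2 * ((‖x‖ ^ 2) ^ 1)⁻¹) +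
      2 * (∫ x, ‖u x‖ ^ 2 * ((‖x‖ ^ 2) ^ 2)⁻¹) := by
    rw [← integral_const_mul, ← integral_const_mul,
      ← integral_add (hI2.const_mul _) (hI4.const_mul _)]
    refine integral_mono_of_nonneg (Filter.Eventually.of_forall fun x => by positivity)
      ((hI2.const_mul _).add (hI4.const_mul _)) ?_
    filter_upwards [hne] with x hx
    exact cb_quot hu1 hx
  -- the gradient
  have hDi : Integrable (fun x => ‖iteratedFDeriv ℝ 2 u x‖ ^ 2) := by
    have hcont : Continuous (iteratedFDeriv ℝ 2 u) := hu2.continuous_iteratedFDeriv le_rfl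
    apply Continuous.integrable_of_hasCompactSupport (by fun_prop)
    exact (hc.iteratedFDeriv (𝕜 := ℝ) 2).comp_left
      (g := fun z : EuclideanSpace ℝ (Fin 3) [×2]→L[ℝ] ℂ => ‖z‖ ^ 2) (by simp)
  have hgi : ∀ i : Fin 3, ContDiff ℝ 1 (fun y => fderiv ℝ u y (EuclideanSpace.single i 1)) :=
    fun i => (hu2.fderiv_right (m := 1) (by norm_num)).clm_apply contDiff_const
  have hgc : ∀ i : Fin 3, HasCompactSupport (fun y => fderiv ℝ u y (EuclideanSpace.single i 1)) :=
    fun i => hc.fderiv_apply ℝ _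
  have hg0 : ∀ i : Fin 3, (0 : EuclideanSpace ℝ (Fin 3)) ∉
      tsupport (fun y => fderiv ℝ u y (EuclideanSpace.single i 1)) :=
    fun i h => h0 (tsupport_fderiv_apply_subset ℝ _ h)
  have hgI : ∀ i : Fin 3, Integrable (fun x : EuclideanSpace ℝ (Fin 3) =>
      ‖fderiv ℝ u x (EuclideanSpace.single i 1)‖ ^ 2 * ((‖x‖ ^ 2) ^ 1)⁻¹) := by
    intro i
    have ht : tsupport (fun x => ‖fderiv ℝ u x (EuclideanSpace.single i 1)‖ ^ 2) ⊆ tsupport u :=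
      (tsupport_comp_subset (g := fun z : ℂ => ‖z‖ ^ 2) (by simp) _).trans
        (tsupport_fderiv_apply_subset ℝ (EuclideanSpace.single i 1))
    exact cb_integrable 1 (by fun_prop)
      (hc.of_isClosed_subset (isClosed_tsupport _) ht) (fun h => h0 (ht h))
  have hgB : ∀ i : Fin 3, ∫ x : EuclideanSpace ℝ (Fin 3),
      ‖fderiv ℝ u x (EuclideanSpace.single i 1)‖ ^ 2 * ((‖x‖ ^ 2) ^ 1)⁻¹ ≤
      4 * ∫ x, ‖iteratedFDeriv ℝ 2 u x‖ ^ 2 := by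
    intro i
    refine (cb_hardy 0 (by norm_num) (hgi i) (hgc i) (hg0 i)).trans ?_
    refine mul_le_mul_of_nonneg_left ?_ (by norm_num)
    refine integral_mono_of_nonneg (Filter.Eventually.of_forall fun x => by positivity) hDi
      (Filter.Eventually.of_forall fun x => ?_)
    have := cb_hess hu2 x i
    simp only [pow_zero, inv_one, mul_one]
    gcongr
  have D : ∫ x, ‖fderiv ℝ u x‖ ^ 2 * ((‖x‖ ^ 2) ^ 1)⁻¹ ≤
      12 * ∫ x, ‖iteratedFDeriv ℝ 2 u x‖ ^ 2 := by
    calc _ ≤ ∫ x : EuclideanSpace ℝ (Fin 3), ∑ i,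
          ‖fderiv ℝ u x (EuclideanSpace.single i 1)‖ ^ 2 * ((‖x‖ ^ 2) ^ 1)⁻¹ := by
          refine integral_mono hI2 (integrable_finsetSum _ fun i _ => hgI i) fun x => ?_
          simp only []
          rw [← Finset.sum_mul]
          exact mul_le_mul_of_nonneg_right (cb_opnorm _) (by positivity)
      _ = ∑ i, ∫ x : EuclideanSpace ℝ (Fin 3),
          ‖fderiv ℝ u x (EuclideanSpace.single i 1)‖ ^ 2 * ((‖x‖ ^ 2) ^ 1)⁻¹ :=
          integral_finsetSum _ fun i _ => hgI i
      _ ≤ ∑ i : Fin 3, 4 * ∫ x, ‖iteratedFDeriv ℝ 2 u x‖ ^ 2 := Finset.sum_le_sum fun i _ => hgB i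
      _ = _ := by simp; ring
  have P0 : 0 ≤ ∫ x, ‖u x‖ ^ 2 := integral_nonneg fun x => by positivity
  have P1 : 0 ≤ ∫ x, ‖fderiv ℝ u x‖ ^ 2 := integral_nonneg fun x => by positivity
  have P2 : 0 ≤ ∫ x, ‖iteratedFDeriv ℝ 2 u x‖ ^ 2 := integral_nonneg fun x => by positivity
  simp only [zero_add, pow_zero, inv_one, mul_one, pow_one, one_add_one_eq_two] at A B Q D
  simp only [div_eq_mul_inv] at *
  linarith
end

section
/- Trilinear Hartree estimate in L²: there exists a constant C > 0 such that for all smooth compactly supported functions u, v, w : ℝ³ → ℂ one has ‖((uv) * |x|^{-1}) w‖_{L²} ≤ C ‖u‖_{L²} ‖v‖_{H¹} ‖w‖_{L²}. -/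
open MeasureTheory


/-- Cauchy-Schwarz for lower integrals. -/
lemma lintegral_cs {α : Type*} [MeasurableSpace α] (μ : Measure α) {f g : α → ENNReal}
    (hf : AEMeasurable f μ) (hg : AEMeasurable g μ) :
    (∫⁻ a, f a * g a ∂μ) ^ 2 ≤ (∫⁻ a, f a ^ 2 ∂μ) * (∫⁻ a, g a ^ 2 ∂μ) := by
  have h := ENNReal.lintegral_mul_le_Lp_mul_Lq μ Real.HolderConjugate.two_two hf hg
  simp only [Pi.mul_apply, ENNReal.rpow_two] at h
  have key : ∀ a : ENNReal, (a ^ (1 / 2 : ℝ)) ^ 2 = a := by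
    intro a
    rw [← ENNReal.rpow_natCast, ← ENNReal.rpow_mul]
    norm_num
  calc _ ≤ ((∫⁻ a, f a ^ 2 ∂μ) ^ (1 / 2 : ℝ) * (∫⁻ a, g a ^ 2 ∂μ) ^ (1 / 2 : ℝ)) ^ 2 := by
        gcongr
    _ = _ := by rw [mul_pow, key, key]

lemma pointwise_bound (f : (EuclideanSpace ℝ (Fin 3)) → ℂ) (hf : ContDiff ℝ (⊤ : ℕ∞) f) (hc : HasCompactSupport f)
    (x : (EuclideanSpace ℝ (Fin 3))) : ‖f x / (‖x‖ : ℂ)‖ₑ ≤ ∫⁻ t in Set.Ioi (1 : ℝ), ‖fderiv ℝ f (t • x)‖ₑ := by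
  by_cases hx : x = 0
  · simp [hx]
  have hx' : 0 < ‖x‖ := norm_pos_iff.mpr hx
  obtain ⟨R, hR⟩ := hc.isCompact.isBounded.subset_closedBall 0
  set T : ℝ := max 1 ((R + 1) / ‖x‖) with hT
  have hT1 : 1 ≤ T := le_max_left _ _
  have hfT : f (T • x) = 0 := by
    apply image_eq_zero_of_notMem_tsupport
    intro hmem
    have := hR hmem
    rw [mem_closedBall_zero_iff, norm_smul, Real.norm_of_nonneg (by linarith)] at this
    have h2 : (R + 1) / ‖x‖ ≤ T := le_max_right _ _
    rw [div_le_iff₀ hx'] at h2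
    linarith
  have hdf : Continuous (fderiv ℝ f) := hf.continuous_fderiv (by simp)
  have hder : ∀ t : ℝ, HasDerivAt (fun t : ℝ => f (t • x)) (fderiv ℝ f (t • x) x) t := by
    intro t
    have h1 : HasFDerivAt f (fderiv ℝ f (t • x)) (t • x) :=
      (hf.differentiable (by simp) _).hasFDerivAt
    have h2 : HasDerivAt (fun t : ℝ => t • x) x t := by
      simpa using (hasDerivAt_id t).smul_const x
    exact h1.comp_hasDerivAt t h2
  have hftc : ∫ t in (1 : ℝ)..T, fderiv ℝ f (t • x) x = - f x := by
    rw [intervalIntegral.integral_eq_sub_of_hasDerivAt (fun t _ => hder t)]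
    · simp [hfT]
    · apply Continuous.intervalIntegrable
      fun_prop
  have hle : ‖f x‖ₑ ≤ (∫⁻ t in Set.Ioi (1 : ℝ), ‖fderiv ℝ f (t • x)‖ₑ) * ‖x‖ₑ := by
    rw [← enorm_neg, ← hftc, intervalIntegral.integral_of_le hT1]
    refine (enorm_integral_le_lintegral_enorm _).trans ?_
    rw [← lintegral_mul_const' _ _ enorm_ne_top]
    refine (lintegral_mono_set Set.Ioc_subset_Ioi_self).trans ?_
    exact lintegral_mono fun t => ContinuousLinearMap.le_opENorm _ _
  have hxx : ‖(‖x‖ : ℂ)‖ₑ = ‖x‖ₑ := by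
    rw [← ofReal_norm, ← ofReal_norm]
    simp
  rw [div_eq_mul_inv, enorm_mul, enorm_inv (by simpa using hx), hxx, ← div_eq_mul_inv]
  exact ENNReal.div_le_of_le_mul hle

lemma lintegral_power : ∫⁻ t in Set.Ioi (1 : ℝ), ENNReal.ofReal (t ^ (-(3/2) : ℝ)) = 2 := by
  rw [← ofReal_integral_eq_lintegral_ofReal, integral_Ioi_rpow_of_lt (by norm_num) (by norm_num)]
  · norm_num
  · exact integrableOn_Ioi_rpow_of_lt (by norm_num) (by norm_num)
  · refine ae_restrict_of_forall_mem measurableSet_Ioi fun t ht => ?_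
    exact Real.rpow_nonneg (by linarith [Set.mem_Ioi.mp ht]) _

lemma lintegral_scale (G : (EuclideanSpace ℝ (Fin 3)) → ENNReal) (hG : Measurable G) {t : ℝ} (ht : 0 < t) :
    ∫⁻ x, G (t • x) = ENNReal.ofReal (t ^ (-3 : ℝ)) * ∫⁻ x, G x := by
  have h := Measure.map_addHaar_smul (volume : Measure (EuclideanSpace ℝ (Fin 3))) ht.ne'
  rw [← lintegral_map hG (measurable_const_smul t), h, lintegral_smul_measure, smul_eq_mul]
  congr 2
  rw [finrank_euclideanSpace_fin, abs_of_pos (by positivity), Real.rpow_neg ht.le]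
  norm_cast

lemma hardy0 (f : (EuclideanSpace ℝ (Fin 3)) → ℂ) (hf : ContDiff ℝ (⊤ : ℕ∞) f) (hc : HasCompactSupport f) :
    ∫⁻ x, ‖f x / (‖x‖ : ℂ)‖ₑ ^ 2 ≤ 4 * ∫⁻ x, ‖fderiv ℝ f x‖ₑ ^ 2 := by
  have hdf : Continuous (fderiv ℝ f) := hf.continuous_fderiv (by simp)
  have hpt : ∀ x : (EuclideanSpace ℝ (Fin 3)), ‖f x / (‖x‖ : ℂ)‖ₑ ^ 2 ≤
      2 * ∫⁻ t in Set.Ioi (1 : ℝ), ENNReal.ofReal (t ^ (3/2 : ℝ)) * ‖fderiv ℝ f (t • x)‖ₑ ^ 2 := by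
    intro x
    calc _ ≤ (∫⁻ t in Set.Ioi (1 : ℝ), ‖fderiv ℝ f (t • x)‖ₑ) ^ 2 := by
          gcongr
          exact pointwise_bound f hf hc x
      _ = (∫⁻ t in Set.Ioi (1 : ℝ), ENNReal.ofReal (t ^ (-(3/4) : ℝ)) *
            (ENNReal.ofReal (t ^ (3/4 : ℝ)) * ‖fderiv ℝ f (t • x)‖ₑ)) ^ 2 := by
          congr 1
          refine setLIntegral_congr_fun measurableSet_Ioi fun t ht => ?_
          have ht0 : 0 < t := by linarith [Set.mem_Ioi.mp ht]
          rw [← mul_assoc, ← ENNReal.ofReal_mul (by positivity), ← Real.rpow_add ht0]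
          norm_num
      _ ≤ _ := lintegral_cs _ (by fun_prop) (by fun_prop)
      _ = _ := by
          congr 1
          · rw [← lintegral_power]
            refine setLIntegral_congr_fun measurableSet_Ioi fun t ht => ?_
            have ht0 : 0 < t := by linarith [Set.mem_Ioi.mp ht]
            rw [← ENNReal.ofReal_pow (by positivity), ← Real.rpow_mul_natCast ht0.le]
            norm_num
          · refine setLIntegral_congr_fun measurableSet_Ioi fun t ht => ?_
            have ht0 : 0 < t := by linarith [Set.mem_Ioi.mp ht]
            rw [mul_pow, ← ENNReal.ofReal_pow (by positivity), ← Real.rpow_mul_natCast ht0.le]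
            norm_num
  calc _ ≤ ∫⁻ x : (EuclideanSpace ℝ (Fin 3)), 2 * ∫⁻ t in Set.Ioi (1 : ℝ),
        ENNReal.ofReal (t ^ (3/2 : ℝ)) * ‖fderiv ℝ f (t • x)‖ₑ ^ 2 := lintegral_mono hpt
    _ = 2 * ∫⁻ t in Set.Ioi (1 : ℝ), ∫⁻ x : (EuclideanSpace ℝ (Fin 3)),
        ENNReal.ofReal (t ^ (3/2 : ℝ)) * ‖fderiv ℝ f (t • x)‖ₑ ^ 2 := by
        rw [lintegral_const_mul' _ _ (by simp), lintegral_lintegral_swap]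
        apply Measurable.aemeasurable
        have : Measurable fun p : (EuclideanSpace ℝ (Fin 3)) × ℝ => fderiv ℝ f (p.2 • p.1) :=
          (hdf.comp (by fun_prop)).measurable
        simp only [Function.uncurry_def]
        fun_prop
    _ = 2 * ∫⁻ t in Set.Ioi (1 : ℝ),
        ENNReal.ofReal (t ^ (-(3/2) : ℝ)) * ∫⁻ x, ‖fderiv ℝ f x‖ₑ ^ 2 := by
        congr 1
        refine setLIntegral_congr_fun measurableSet_Ioi fun t ht => ?_
        have ht0 : 0 < t := by linarith [Set.mem_Ioi.mp ht]
        rw [lintegral_const_mul' _ _ (by simp),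
          lintegral_scale (fun x => ‖fderiv ℝ f x‖ₑ ^ 2) (by fun_prop) ht0, ← mul_assoc,
          ← ENNReal.ofReal_mul (by positivity), ← Real.rpow_add ht0]
        norm_num
    _ = _ := by
        rw [lintegral_mul_const _ (by fun_prop), lintegral_power, ← mul_assoc]
        norm_num

lemma hardy (v : (EuclideanSpace ℝ (Fin 3)) → ℂ) (hv : ContDiff ℝ (⊤ : ℕ∞) v) (hc : HasCompactSupport v) (x : (EuclideanSpace ℝ (Fin 3))) :
    ∫⁻ y, ‖v y / (‖x - y‖ : ℂ)‖ₑ ^ 2 ≤ 4 * ∫⁻ y, ‖fderiv ℝ v y‖ₑ ^ 2 := by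
  have h := hardy0 (fun z => v (x + z)) (by fun_prop)
    (hc.comp_homeomorph (Homeomorph.addLeft x))
  simp only [fderiv_comp_add_left] at h
  rw [lintegral_add_left_eq_self (fun y => ‖fderiv ℝ v y‖ₑ ^ 2) x] at h
  rw [← lintegral_add_left_eq_self _ x]
  simpa using h

lemma lintegral_sq_eq {F : Type*} [NormedAddCommGroup F] (f : (EuclideanSpace ℝ (Fin 3)) → F) (hf : Continuous f)
    (hc : HasCompactSupport f) : ∫⁻ x, ‖f x‖ₑ ^ 2 = ENNReal.ofReal (∫ x, ‖f x‖ ^ 2) := by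
  rw [ofReal_integral_eq_lintegral_ofReal]
  · refine lintegral_congr fun x => ?_
    rw [ENNReal.ofReal_pow (norm_nonneg _), ofReal_norm]
  · apply Continuous.integrable_of_hasCompactSupport (by fun_prop)
    exact hc.comp_left (g := fun z : F => ‖z‖ ^ 2) (by simp)
  · exact Filter.Eventually.of_forall fun x => by positivity

lemma potential_bound (u v : (EuclideanSpace ℝ (Fin 3)) → ℂ) (hu : ContDiff ℝ (⊤ : ℕ∞) u) (huc : HasCompactSupport u)
    (hv : ContDiff ℝ (⊤ : ℕ∞) v) (hvc : HasCompactSupport v) (x : (EuclideanSpace ℝ (Fin 3))) :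
    ‖∫ y, u y * v y / (‖x - y‖ : ℂ)‖ ^ 2 ≤
      4 * (∫ y, ‖u y‖ ^ 2) * (∫ y, ‖fderiv ℝ v y‖ ^ 2) := by
  have hA : 0 ≤ ∫ y, ‖u y‖ ^ 2 := integral_nonneg fun y => by positivity
  have hB : 0 ≤ ∫ y, ‖fderiv ℝ v y‖ ^ 2 := integral_nonneg fun y => by positivity
  have hdv : Continuous (fderiv ℝ v) := hv.continuous_fderiv (by simp)
  have hum : Measurable u := hu.continuous.measurable
  have hvm : Measurable v := hv.continuous.measurable
  have h : ‖∫ y, u y * v y / (‖x - y‖ : ℂ)‖ₑ ^ 2 ≤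
      (∫⁻ y, ‖u y‖ₑ ^ 2) * (4 * ∫⁻ y, ‖fderiv ℝ v y‖ₑ ^ 2) := by
    calc _ ≤ (∫⁻ y, ‖u y‖ₑ * ‖v y / (‖x - y‖ : ℂ)‖ₑ) ^ 2 := by
          gcongr
          refine (enorm_integral_le_lintegral_enorm _).trans_eq ?_
          refine lintegral_congr fun y => ?_
          rw [mul_div_assoc, enorm_mul]
      _ ≤ _ := lintegral_cs _ (by fun_prop) (by fun_prop)
      _ ≤ _ := by
          gcongr
          exact hardy v hv hvc x
  rw [lintegral_sq_eq u hu.continuous huc, lintegral_sq_eq _ hdv (hvc.fderiv ℝ),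
    ← ofReal_norm, ← ENNReal.ofReal_pow (norm_nonneg _),
    show (4 : ENNReal) = ENNReal.ofReal 4 by norm_num, ← ENNReal.ofReal_mul (by norm_num),
    ← ENNReal.ofReal_mul hA, ENNReal.ofReal_le_ofReal_iff (by positivity)] at h
  linarith

/-- Trilinear Hartree estimate in `L²`: there is `C > 0` such that for all smooth compactly
supported `u, v, w : ℝ³ → ℂ`, `‖((uv) * |x|⁻¹) w‖_{L²} ≤ C ‖u‖_{L²} ‖v‖_{H¹} ‖w‖_{L²}`. -/
theorem hartree_trilinear_L2 :
    ∃ C : ℝ, 0 < C ∧ ∀ u v w : EuclideanSpace ℝ (Fin 3) → ℂ,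
      ContDiff ℝ (⊤ : ℕ∞) u → HasCompactSupport u →
      ContDiff ℝ (⊤ : ℕ∞) v → HasCompactSupport v →
      ContDiff ℝ (⊤ : ℕ∞) w → HasCompactSupport w →
      Real.sqrt (∫ x : EuclideanSpace ℝ (Fin 3),
          ‖(∫ y : EuclideanSpace ℝ (Fin 3), u y * v y / (‖x - y‖ : ℂ)) * w x‖ ^ 2) ≤
        C * Real.sqrt (∫ x : EuclideanSpace ℝ (Fin 3), ‖u x‖ ^ 2) *
          Real.sqrt ((∫ x : EuclideanSpace ℝ (Fin 3), ‖v x‖ ^ 2) +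
            (∫ x : EuclideanSpace ℝ (Fin 3), ‖fderiv ℝ v x‖ ^ 2)) *
          Real.sqrt (∫ x : EuclideanSpace ℝ (Fin 3), ‖w x‖ ^ 2) := by
  refine ⟨2, by norm_num, fun u v w hu huc hv hvc hw hwc => ?_⟩
  have hA : 0 ≤ ∫ y, ‖u y‖ ^ 2 := integral_nonneg fun y => by positivity
  have hB : 0 ≤ ∫ y, ‖fderiv ℝ v y‖ ^ 2 := integral_nonneg fun y => by positivity
  have hV : 0 ≤ ∫ y, ‖v y‖ ^ 2 := integral_nonneg fun y => by positivity
  have hW : 0 ≤ ∫ y, ‖w y‖ ^ 2 := integral_nonneg fun y => by positivity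
  have hwi : Integrable fun y => ‖w y‖ ^ 2 := by
    have := hw.continuous
    apply Continuous.integrable_of_hasCompactSupport (by fun_prop)
    exact hwc.comp_left (g := fun z : ℂ => ‖z‖ ^ 2) (by simp)
  apply Real.sqrt_le_iff.mpr
  refine ⟨by positivity, ?_⟩
  rw [mul_pow, mul_pow, mul_pow, Real.sq_sqrt hA, Real.sq_sqrt (by positivity), Real.sq_sqrt hW]
  calc _ ≤ ∫ x, (4 * (∫ y, ‖u y‖ ^ 2) * (∫ y, ‖fderiv ℝ v y‖ ^ 2)) * ‖w x‖ ^ 2 := by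
        apply integral_mono_of_nonneg
        · exact Filter.Eventually.of_forall fun x => by positivity
        · exact hwi.const_mul _
        · refine Filter.Eventually.of_forall fun x => ?_
          simp only
          rw [norm_mul, mul_pow]
          gcongr
          exact potential_bound u v hu huc hv hvc x
    _ = 4 * (∫ y, ‖u y‖ ^ 2) * (∫ y, ‖fderiv ℝ v y‖ ^ 2) * ∫ x, ‖w x‖ ^ 2 :=
        integral_const_mul _ _
    _ ≤ _ := by
        norm_num only
        gcongr
        linarith
end

section
/- Trilinear Hartree estimate in H¹: there exists a constant C > 0 such that for all smooth compactly supported functions u, v, w : ℝ³ → ℂ one has ‖((uv) * |x|^{-1}) w‖_{H¹} ≤ C ‖u‖_{H¹} ‖v‖_{H¹} ‖w‖_{H¹}. -/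
open MeasureTheory

/-- The `H¹` norm squared of a function `ℝ³ → ℂ`: `∫ |f|² + ∫ |∇f|²`. -/
noncomputable def H1normSq (f : EuclideanSpace ℝ (Fin 3) → ℂ) : ℝ :=
  (∫ x : EuclideanSpace ℝ (Fin 3), ‖f x‖ ^ 2) +
    (∫ x : EuclideanSpace ℝ (Fin 3), ‖fderiv ℝ f x‖ ^ 2)

open MeasureTheory Filter Topology

abbrev E3 := EuclideanSpace ℝ (Fin 3)

lemma hart_dg (a : E3) (ε : ℝ) (hε : 0 < ε) (i : Fin 3) (y : E3) :
    HasFDerivAt (fun y : E3 => (y i - a i) * (‖y - a‖ ^ 2 + ε)⁻¹)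
      ((y i - a i) • (-((‖y - a‖ ^ 2 + ε) ^ 2)⁻¹ • (2 • (innerSL ℝ (y - a)))) +
        (‖y - a‖ ^ 2 + ε)⁻¹ • (EuclideanSpace.proj i : E3 →L[ℝ] ℝ)) y := by
  have h1 : HasFDerivAt (fun y : E3 => y i - a i) (EuclideanSpace.proj i : E3 →L[ℝ] ℝ) y :=
    ((EuclideanSpace.proj i : E3 →L[ℝ] ℝ).hasFDerivAt).sub_const _
  have h2 : HasFDerivAt (fun y : E3 => ‖y - a‖ ^ 2 + ε) (2 • (innerSL ℝ (y - a))) y := by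
    have := ((hasFDerivAt_id (𝕜 := ℝ) y).sub_const a).norm_sq.add_const ε
    simpa using this
  have hne : ‖y - a‖ ^ 2 + ε ≠ 0 := by positivity
  exact h1.mul ((hasDerivAt_inv hne).comp_hasFDerivAt y h2)

lemma hart_smooth_g (a : E3) (ε : ℝ) (hε : 0 < ε) (i : Fin 3) :
    ContDiff ℝ 1 (fun y : E3 => (y i - a i) * (‖y - a‖ ^ 2 + ε)⁻¹) := by
  refine ContDiff.mul ?_ (ContDiff.inv ?_ ?_)
  · exact ((EuclideanSpace.proj i : E3 →L[ℝ] ℝ).contDiff).sub contDiff_const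
  · exact ((contDiff_id.sub contDiff_const).norm_sq ℝ).add contDiff_const
  · intro y; positivity

lemma hart_int_fderiv (v : E3 → ℂ) (hv : ContDiff ℝ 1 v) (hc : HasCompactSupport v) :
    Integrable (fun y => ‖fderiv ℝ v y‖ ^ 2) := by
  have h1 : Continuous (fun y => ‖fderiv ℝ v y‖ ^ 2) :=
    (hv.continuous_fderiv one_ne_zero).norm.pow 2
  have h2 : HasCompactSupport (fun y => ‖fderiv ℝ v y‖ ^ 2) := by
    have h3 : HasCompactSupport (fun y => ‖fderiv ℝ v y‖) := (hc.fderiv ℝ).norm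
    exact h3.comp_left (g := fun z : ℝ => z ^ 2) (by simp)
  exact h1.integrable_of_hasCompactSupport h2

lemma hart_eps (v : E3 → ℂ) (hv : ContDiff ℝ 1 v) (hc : HasCompactSupport v) (a : E3)
    (ε : ℝ) (hε : 0 < ε) :
    ∫ y, ‖v y‖ ^ 2 * (‖y - a‖ ^ 2 + ε)⁻¹ ≤ 4 * ∫ y, ‖fderiv ℝ v y‖ ^ 2 := by
  set f : E3 → ℝ := fun y => ‖v y‖ ^ 2 with hf
  set g : Fin 3 → E3 → ℝ := fun i y => (y i - a i) * (‖y - a‖ ^ 2 + ε)⁻¹ with hg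
  let e : Fin 3 → E3 := fun i => EuclideanSpace.single i 1
  have hfs : ContDiff ℝ 1 f := hv.norm_sq ℝ
  have hfc : HasCompactSupport f := by
    have := hc.comp_left (g := fun z : ℂ => ‖z‖ ^ 2) (by simp)
    exact this
  have hgs : ∀ i, ContDiff ℝ 1 (g i) := fun i => hart_smooth_g a ε hε i
  have hfd : ∀ y h, fderiv ℝ f y h = 2 * inner ℝ (v y) (fderiv ℝ v y h) := by
    intro y h
    have := ((hv.differentiable one_ne_zero).differentiableAt (x := y)).hasFDerivAt.norm_sq
    rw [this.fderiv]; simp; ring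
  have hcont : Continuous (fun y : E3 => (‖y - a‖ ^ 2 + ε)⁻¹) :=
    Continuous.inv₀ (by fun_prop) (fun y => by positivity)
  have hfdc : ∀ h, Continuous fun y => fderiv ℝ f y h := fun h =>
    (hfs.continuous_fderiv one_ne_zero).clm_apply continuous_const
  have hgdc : ∀ i h, Continuous fun y => fderiv ℝ (g i) y h := fun i h =>
    ((hgs i).continuous_fderiv one_ne_zero).clm_apply continuous_const
  have i1 : ∀ i, Integrable (fun y => fderiv ℝ f y (e i) * g i y) := fun i =>
    ((hfdc _).mul (hgs i).continuous).integrable_of_hasCompactSupport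
      ((hfc.fderiv_apply ℝ (e i)).mul_right)
  have i2 : ∀ i, Integrable (fun y => f y * fderiv ℝ (g i) y (e i)) := fun i =>
    (hfs.continuous.mul (hgdc i _)).integrable_of_hasCompactSupport hfc.mul_right
  have i3 : ∀ i, Integrable (fun y => f y * g i y) := fun i =>
    (hfs.continuous.mul (hgs i).continuous).integrable_of_hasCompactSupport hfc.mul_right
  have ibp : ∀ i, ∫ y, f y * fderiv ℝ (g i) y (e i) = - ∫ y, fderiv ℝ f y (e i) * g i y :=
    fun i => integral_mul_fderiv_eq_neg_fderiv_mul_of_integrable (i1 i) (i2 i) (i3 i)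
      (fun x _ => (hfs.differentiable one_ne_zero).differentiableAt)
      (fun x _ => ((hgs i).differentiable one_ne_zero).differentiableAt)
  have tot : ∫ y, ∑ i, f y * fderiv ℝ (g i) y (e i) = ∫ y, -∑ i, fderiv ℝ f y (e i) * g i y := by
    rw [integral_neg, integral_finsetSum _ (fun i _ => i2 i), integral_finsetSum _ (fun i _ => i1 i),
      ← Finset.sum_neg_distrib]
    exact Finset.sum_congr rfl fun i _ => ibp i
  have hn : ∀ y : E3, ‖y - a‖ ^ 2 = ∑ i, (y i - a i) ^ 2 := fun y => by
    rw [EuclideanSpace.norm_sq_eq]; simp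
  have p1 : ∀ y, f y * (‖y - a‖ ^ 2 + ε)⁻¹ ≤ ∑ i, f y * fderiv ℝ (g i) y (e i) := by
    intro y
    rw [← Finset.mul_sum]
    refine mul_le_mul_of_nonneg_left ?_ (by positivity)
    have : ∀ i, fderiv ℝ (g i) y (e i) = (‖y - a‖ ^ 2 + ε)⁻¹ -
        2 * (y i - a i) ^ 2 * ((‖y - a‖ ^ 2 + ε)⁻¹) ^ 2 := by
      intro i
      rw [(hart_dg a ε hε i y).fderiv]
      simp [e, EuclideanSpace.inner_single_right]
      ring
    simp_rw [this]
    rw [Finset.sum_sub_distrib, ← Finset.sum_mul, ← Finset.mul_sum, ← hn]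
    simp only [Finset.sum_const, Finset.card_univ, Fintype.card_fin]
    have hp : 0 < ‖y - a‖ ^ 2 + ε := by positivity
    have hp' : 0 < (‖y - a‖ ^ 2 + ε)⁻¹ := by positivity
    have h1 : (‖y - a‖ ^ 2 + ε) * (‖y - a‖ ^ 2 + ε)⁻¹ = 1 := mul_inv_cancel₀ hp.ne'
    generalize (‖y - a‖ ^ 2 + ε)⁻¹ = r at *
    have : ‖y - a‖ ^ 2 * r ≤ 1 := by nlinarith
    simp only [nsmul_eq_mul]; push_cast
    nlinarith
  have p2 : ∀ y, -∑ i, fderiv ℝ f y (e i) * g i y ≤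
      (1/2) * (f y * (‖y - a‖ ^ 2 + ε)⁻¹) + 2 * ‖fderiv ℝ v y‖ ^ 2 := by
    intro y
    have hs : ∑ i, fderiv ℝ f y (e i) * g i y = fderiv ℝ f y (y - a) * (‖y - a‖ ^ 2 + ε)⁻¹ := by
      have : y - a = ∑ i, (y i - a i) • e i := by
        ext j
        simp [e, Fin.sum_univ_three]
        fin_cases j <;> simp
      conv_rhs => rw [this]
      rw [map_sum, Finset.sum_mul]
      refine Finset.sum_congr rfl fun i _ => ?_
      rw [← this, map_smul, smul_eq_mul]; simp only [hg]; ring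
    rw [hs, hfd]
    have hb : |inner ℝ (v y) (fderiv ℝ v y (y - a))| ≤ ‖v y‖ * (‖fderiv ℝ v y‖ * ‖y - a‖) :=
      (abs_real_inner_le_norm _ _).trans
        (mul_le_mul_of_nonneg_left ((fderiv ℝ v y).le_opNorm _) (norm_nonneg _))
    have hb' := (abs_le.1 hb).1
    have hp : 0 < ‖y - a‖ ^ 2 + ε := by positivity
    have hp' : 0 < (‖y - a‖ ^ 2 + ε)⁻¹ := by positivity
    have h1 : (‖y - a‖ ^ 2 + ε) * (‖y - a‖ ^ 2 + ε)⁻¹ = 1 := mul_inv_cancel₀ hp.ne'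
    simp only [hf]
    generalize (‖y - a‖ ^ 2 + ε)⁻¹ = r at *
    have h3 : ‖y - a‖ ^ 2 * r ≤ 1 := by nlinarith
    have h4 : 0 ≤ (1/2) * r * (‖v y‖ - 2 * (‖fderiv ℝ v y‖ * ‖y - a‖)) ^ 2 := by positivity
    have h5 : ‖fderiv ℝ v y‖ ^ 2 * (‖y - a‖ ^ 2 * r) ≤ ‖fderiv ℝ v y‖ ^ 2 * 1 :=
      mul_le_mul_of_nonneg_left h3 (by positivity)
    have h6 := mul_le_mul_of_nonneg_right hb' hp'.le
    linarith
  have j1 : Integrable (fun y => f y * (‖y - a‖ ^ 2 + ε)⁻¹) :=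
    (hfs.continuous.mul hcont).integrable_of_hasCompactSupport hfc.mul_right
  have j2 : Integrable (fun y => ‖fderiv ℝ v y‖ ^ 2) := hart_int_fderiv v hv hc
  have q1 := integral_mono j1 (integrable_finsetSum _ fun i _ => i2 i) p1
  have q2 := integral_mono (integrable_finsetSum _ fun i _ => i1 i).neg
    ((j1.const_mul (1/2)).add (j2.const_mul 2)) p2
  have q3 : ∫ y, ((1/2) * (f y * (‖y - a‖ ^ 2 + ε)⁻¹) + 2 * ‖fderiv ℝ v y‖ ^ 2) =
    (1/2) * (∫ y, f y * (‖y - a‖ ^ 2 + ε)⁻¹) + 2 * ∫ y, ‖fderiv ℝ v y‖ ^ 2 := by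
    rw [integral_add (j1.const_mul _) (j2.const_mul _), integral_const_mul, integral_const_mul]
  have q2' : ∫ y, -∑ i, fderiv ℝ f y (e i) * g i y ≤
    ∫ y, ((1/2) * (f y * (‖y - a‖ ^ 2 + ε)⁻¹) + 2 * ‖fderiv ℝ v y‖ ^ 2) := q2
  rw [q3] at q2'
  linarith

lemma hart_hardy (v : E3 → ℂ) (hv : ContDiff ℝ 1 v) (hc : HasCompactSupport v) (a : E3) :
    ∫⁻ y, ENNReal.ofReal (‖v y‖ ^ 2 * (‖y - a‖ ^ 2)⁻¹) ≤
      ENNReal.ofReal (4 * ∫ y, ‖fderiv ℝ v y‖ ^ 2) := by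
  let ε : ℕ → ℝ := fun n => 1 / ((n : ℝ) + 1)
  have hε : ∀ n, 0 < ε n := fun n => by positivity
  have hε0 : Tendsto ε atTop (𝓝 0) := tendsto_one_div_add_atTop_nhds_zero_nat
  have hcont : ∀ n, Continuous (fun y : E3 => ‖v y‖ ^ 2 * (‖y - a‖ ^ 2 + ε n)⁻¹) := fun n =>
    (hv.continuous.norm.pow 2).mul
      (Continuous.inv₀ (by fun_prop) (fun y => by have := hε n; positivity))
  have hfc : HasCompactSupport (fun y => ‖v y‖ ^ 2) :=
    hc.comp_left (g := fun z : ℂ => ‖z‖ ^ 2) (by simp)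
  have hb : ∀ n, ∫⁻ y, ENNReal.ofReal (‖v y‖ ^ 2 * (‖y - a‖ ^ 2 + ε n)⁻¹) ≤
      ENNReal.ofReal (4 * ∫ y, ‖fderiv ℝ v y‖ ^ 2) := by
    intro n
    rw [← ofReal_integral_eq_lintegral_ofReal
      ((hcont n).integrable_of_hasCompactSupport hfc.mul_right)
      (Eventually.of_forall fun y => by have := hε n; positivity)]
    exact ENNReal.ofReal_le_ofReal (hart_eps v hv hc a _ (hε n))
  have hlim : ∀ᵐ y : E3, ENNReal.ofReal (‖v y‖ ^ 2 * (‖y - a‖ ^ 2)⁻¹) =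
      liminf (fun n => ENNReal.ofReal (‖v y‖ ^ 2 * (‖y - a‖ ^ 2 + ε n)⁻¹)) atTop := by
    have : ∀ᵐ y : E3, y ≠ a := by
      rw [ae_iff]; simp
    filter_upwards [this] with y hy
    have hne : ‖y - a‖ ^ 2 ≠ 0 := pow_ne_zero _ (norm_ne_zero_iff.2 (sub_ne_zero.2 hy))
    refine (Tendsto.liminf_eq ?_).symm
    refine ENNReal.tendsto_ofReal (Tendsto.const_mul _ (Tendsto.inv₀ ?_ hne))
    simpa using hε0.const_add (‖y - a‖ ^ 2)
  rw [lintegral_congr_ae hlim]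
  refine (lintegral_liminf_le fun n => ((hcont n).measurable.ennreal_ofReal)).trans ?_
  exact liminf_le_of_le (by isBoundedDefault) fun b hb' =>
    let ⟨n, hn⟩ := hb'.exists
    hn.trans (hb n)

lemma hart_cs (f : E3 → ℝ) (hf : Continuous f) (hfc : HasCompactSupport f) (hf0 : ∀ y, 0 ≤ f y)
    (v : E3 → ℂ) (hv : ContDiff ℝ 1 v) (hc : HasCompactSupport v) (a : E3) :
    Integrable (fun y => f y * (‖v y‖ * ‖a - y‖⁻¹)) ∧
    ∫ y, f y * (‖v y‖ * ‖a - y‖⁻¹) ≤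
      2 * (√(∫ y, f y ^ 2) * √(∫ y, ‖fderiv ℝ v y‖ ^ 2)) := by
  have hH := hart_hardy v hv hc a
  have hm : Measurable (fun y : E3 => ‖v y‖ * ‖a - y‖⁻¹) :=
    hv.continuous.norm.measurable.mul (by fun_prop)
  have hsq : ∀ y : E3, (‖v y‖ * ‖a - y‖⁻¹) ^ 2 = ‖v y‖ ^ 2 * (‖y - a‖ ^ 2)⁻¹ := fun y => by
    rw [norm_sub_rev]; ring
  have hI : Integrable (fun y : E3 => (‖v y‖ * ‖a - y‖⁻¹) ^ 2) := by
    refine ⟨(hm.pow_const 2).aestronglyMeasurable, ?_⟩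
    rw [hasFiniteIntegral_iff_ofReal (Eventually.of_forall fun y => by positivity)]
    simp_rw [hsq]
    exact hH.trans_lt ENNReal.ofReal_lt_top
  have hD0 : 0 ≤ ∫ y, ‖fderiv ℝ v y‖ ^ 2 := integral_nonneg fun y => by positivity
  have hIb : ∫ y : E3, (‖v y‖ * ‖a - y‖⁻¹) ^ 2 ≤ 4 * ∫ y, ‖fderiv ℝ v y‖ ^ 2 := by
    rw [integral_eq_lintegral_of_nonneg_ae (Eventually.of_forall fun y => by positivity)
      hI.aestronglyMeasurable]
    simp_rw [hsq]
    exact ENNReal.toReal_le_of_le_ofReal (by positivity) hH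
  have m1 : MemLp f (ENNReal.ofReal 2) := hf.memLp_of_hasCompactSupport hfc
  have m2 : MemLp (fun y : E3 => ‖v y‖ * ‖a - y‖⁻¹) (ENNReal.ofReal 2) := by
    have := (memLp_two_iff_integrable_sq hm.aestronglyMeasurable).2 hI
    simpa using this
  refine ⟨?_, ?_⟩
  · have m1' : MemLp f 2 := by simpa using m1
    have m2' : MemLp (fun y : E3 => ‖v y‖ * ‖a - y‖⁻¹) 2 := by simpa using m2
    exact m1'.integrable_mul m2'
  have h := integral_mul_le_Lp_mul_Lq_of_nonneg Real.HolderConjugate.two_two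
    (Eventually.of_forall hf0) (Eventually.of_forall fun y => by positivity) m1 m2
  refine h.trans ?_
  simp_rw [← Real.sqrt_eq_rpow, Real.rpow_two]
  have : √(∫ y : E3, (‖v y‖ * ‖a - y‖⁻¹) ^ 2) ≤ 2 * √(∫ y, ‖fderiv ℝ v y‖ ^ 2) := by
    refine (Real.sqrt_le_sqrt hIb).trans_eq ?_
    rw [Real.sqrt_mul (by norm_num)]
    congr 1
    rw [show (4:ℝ) = 2 ^ 2 by norm_num]; exact Real.sqrt_sq (by norm_num)
  calc _ ≤ √(∫ y, f y ^ 2) * (2 * √(∫ y, ‖fderiv ℝ v y‖ ^ 2)) :=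
        mul_le_mul_of_nonneg_left this (Real.sqrt_nonneg _)
    _ = _ := by ring

lemma hart_loc : LocallyIntegrable (fun t : E3 => ((‖t‖ : ℂ))⁻¹) := by
  refine locallyIntegrable_of_norm_le_rpow (C := 1) (α := 1) ?_ ?_ ?_ ?_
  · simp
  · simp
  · refine Eventually.of_forall fun x => ?_
    simp [Real.rpow_neg_one]
  · have : Measurable (fun t : E3 => ((‖t‖ : ℂ))⁻¹) := by fun_prop
    exact this.aestronglyMeasurable

lemma hart_phi (u v : E3 → ℂ) (hu : ContDiff ℝ 1 u) (huc : HasCompactSupport u)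
    (hv : ContDiff ℝ 1 v) (hvc : HasCompactSupport v) (x : E3) :
    let φ : E3 → ℂ := fun x => ∫ y : E3, u y * v y / (‖x - y‖ : ℂ)
    DifferentiableAt ℝ φ x ∧ ‖φ x‖ ≤ 4 * √(H1normSq u) * √(H1normSq v) ∧
      ‖fderiv ℝ φ x‖ ≤ 4 * √(H1normSq u) * √(H1normSq v) := by
  intro φ
  have a1 : √(∫ y, ‖u y‖ ^ 2) ≤ √(H1normSq u) :=
    Real.sqrt_le_sqrt (le_add_of_nonneg_right (integral_nonneg fun y => by positivity))
  have a2 : ∀ u : E3 → ℂ, √(∫ y, ‖fderiv ℝ u y‖ ^ 2) ≤ √(H1normSq u) := fun u =>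
    Real.sqrt_le_sqrt (le_add_of_nonneg_left (integral_nonneg fun y => by positivity))
  have nn : 0 ≤ √(H1normSq u) * √(H1normSq v) := by positivity
  set g : E3 → ℂ := fun y => u y * v y with hg
  have hgs : ContDiff ℝ 1 g := hu.mul hv
  have hgc : HasCompactSupport g := huc.mul_right
  set k : E3 → ℂ := fun t => ((‖t‖ : ℂ))⁻¹ with hk
  let L := ContinuousLinearMap.mul ℝ ℂ
  have hconv : φ = convolution k g L volume := by
    funext x
    simp only [φ, convolution]
    rw [← integral_sub_left_eq_self _ volume x]
    refine integral_congr_ae (Eventually.of_forall fun t => ?_)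
    simp [L, hk, hg]
    ring
  have hder : HasFDerivAt φ ((convolution k (fderiv ℝ g) (L.precompR E3) volume) x) x := by
    rw [hconv]
    exact hgc.hasFDerivAt_convolution_right L hart_loc hgs x
  refine ⟨hder.differentiableAt, ?_, ?_⟩
  · obtain ⟨-, hb⟩ := hart_cs (fun y => ‖u y‖) hu.continuous.norm huc.norm
      (fun y => norm_nonneg _) v hv hvc x
    have : ‖φ x‖ ≤ ∫ y, ‖u y‖ * (‖v y‖ * ‖x - y‖⁻¹) := by
      refine (norm_integral_le_integral_norm _).trans_eq ?_
      refine integral_congr_ae (Eventually.of_forall fun t => ?_)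
      simp; ring
    have := mul_le_mul a1 (a2 v) (Real.sqrt_nonneg _) (Real.sqrt_nonneg _)
    linarith
  · rw [hder.fderiv]
    obtain ⟨ib, hb⟩ := hart_cs (fun y => ‖fderiv ℝ u y‖)
      (hu.continuous_fderiv one_ne_zero).norm (huc.fderiv ℝ).norm
      (fun y => norm_nonneg _) v hv hvc x
    obtain ⟨ib', hb'⟩ := hart_cs (fun y => ‖fderiv ℝ v y‖)
      (hv.continuous_fderiv one_ne_zero).norm (hvc.fderiv ℝ).norm
      (fun y => norm_nonneg _) u hu huc x
    have key : ‖(convolution k (fderiv ℝ g) (L.precompR E3) volume) x‖ ≤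
        ∫ y, (‖fderiv ℝ u y‖ * (‖v y‖ * ‖x - y‖⁻¹) + ‖fderiv ℝ v y‖ * (‖u y‖ * ‖x - y‖⁻¹)) := by
      rw [convolution, ← integral_sub_left_eq_self _ volume x]
      refine norm_integral_le_of_norm_le (ib.add ib') (Eventually.of_forall fun y => ?_)
      rw [sub_sub_cancel]
      have hd : fderiv ℝ g y = u y • fderiv ℝ v y + v y • fderiv ℝ u y :=
        fderiv_mul (hu.differentiable one_ne_zero).differentiableAt
          (hv.differentiable one_ne_zero).differentiableAt
      have hn : ‖fderiv ℝ g y‖ ≤ ‖u y‖ * ‖fderiv ℝ v y‖ + ‖v y‖ * ‖fderiv ℝ u y‖ := by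
        rw [hd]
        refine (norm_add_le _ _).trans ?_
        rw [norm_smul, norm_smul]
      have h1 : ‖(L.precompR E3) (k (x - y)) (fderiv ℝ g y)‖ ≤ ‖x - y‖⁻¹ * ‖fderiv ℝ g y‖ := by
        refine ContinuousLinearMap.opNorm_le_bound _ (by positivity) fun h => ?_
        rw [ContinuousLinearMap.precompR_apply]
        have hkn : ‖k (x - y)‖ = ‖x - y‖⁻¹ := by simp [hk]
        change ‖k (x - y) * fderiv ℝ g y h‖ ≤ _
        rw [norm_mul, hkn]
        rw [mul_assoc]
        exact mul_le_mul_of_nonneg_left ((fderiv ℝ g y).le_opNorm h) (by positivity)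
      refine h1.trans ((mul_le_mul_of_nonneg_left hn (by positivity)).trans_eq ?_)
      ring
    rw [integral_add ib ib'] at key
    have t1 := mul_le_mul (a2 u) (a2 v) (Real.sqrt_nonneg _) (Real.sqrt_nonneg _)
    linarith

lemma hart_mul (φ w : E3 → ℂ) (M : ℝ) (hM0 : 0 ≤ M) (hw : ContDiff ℝ 1 w)
    (hwc : HasCompactSupport w)
    (H : ∀ x, DifferentiableAt ℝ φ x ∧ ‖φ x‖ ≤ M ∧ ‖fderiv ℝ φ x‖ ≤ M) :
    H1normSq (fun x => φ x * w x) ≤ (2 * M) ^ 2 * H1normSq w := by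
  have hfc : HasCompactSupport (fun y => ‖w y‖ ^ 2) :=
    hwc.comp_left (g := fun z : ℂ => ‖z‖ ^ 2) (by simp)
  have j1 : Integrable (fun y => ‖w y‖ ^ 2) :=
    (hw.continuous.norm.pow 2).integrable_of_hasCompactSupport hfc
  have j2 : Integrable (fun y => ‖fderiv ℝ w y‖ ^ 2) := hart_int_fderiv w hw hwc
  have b1 : ∫ x, ‖φ x * w x‖ ^ 2 ≤ ∫ x, M ^ 2 * ‖w x‖ ^ 2 := by
    refine integral_mono_of_nonneg (Eventually.of_forall fun x => by positivity)
      (j1.const_mul _) (Eventually.of_forall fun x => ?_)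
    simp only [norm_mul, mul_pow]
    gcongr
    exact (H x).2.1
  have b2 : ∫ x, ‖fderiv ℝ (fun x => φ x * w x) x‖ ^ 2 ≤
      ∫ x, (2 * M ^ 2 * ‖w x‖ ^ 2 + 2 * M ^ 2 * ‖fderiv ℝ w x‖ ^ 2) := by
    refine integral_mono_of_nonneg (Eventually.of_forall fun x => by positivity)
      ((j1.const_mul _).add (j2.const_mul _)) (Eventually.of_forall fun x => ?_)
    have hd : fderiv ℝ (fun x => φ x * w x) x = φ x • fderiv ℝ w x + w x • fderiv ℝ φ x :=
      fderiv_mul (H x).1 (hw.differentiable one_ne_zero).differentiableAt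
    have hn : ‖fderiv ℝ (fun x => φ x * w x) x‖ ≤ M * ‖fderiv ℝ w x‖ + ‖w x‖ * M := by
      rw [hd]
      refine (norm_add_le _ _).trans ?_
      rw [norm_smul, norm_smul]
      gcongr
      · exact (H x).2.1
      · exact (H x).2.2
    have := pow_le_pow_left₀ (norm_nonneg _) hn 2
    simp only
    nlinarith [sq_nonneg (M * ‖fderiv ℝ w x‖ - ‖w x‖ * M)]
  rw [integral_const_mul] at b1
  rw [integral_add (j1.const_mul _) (j2.const_mul _), integral_const_mul, integral_const_mul] at b2
  have c1 : 0 ≤ ∫ x, ‖w x‖ ^ 2 := integral_nonneg fun y => by positivity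
  have c2 : 0 ≤ ∫ x, ‖fderiv ℝ w x‖ ^ 2 := integral_nonneg fun y => by positivity
  · unfold H1normSq
    have := mul_nonneg (sq_nonneg M) c1
    have := mul_nonneg (sq_nonneg M) c2
    linarith

/-- Trilinear Hartree estimate in `H¹`: there is `C > 0` such that for all smooth compactly
supported `u, v, w : ℝ³ → ℂ`, `‖((uv) * |x|⁻¹) w‖_{H¹} ≤ C ‖u‖_{H¹} ‖v‖_{H¹} ‖w‖_{H¹}`. -/
theorem hartree_trilinear_H1 :
    ∃ C : ℝ, 0 < C ∧ ∀ u v w : EuclideanSpace ℝ (Fin 3) → ℂ,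
      ContDiff ℝ (⊤ : ℕ∞) u → HasCompactSupport u →
      ContDiff ℝ (⊤ : ℕ∞) v → HasCompactSupport v →
      ContDiff ℝ (⊤ : ℕ∞) w → HasCompactSupport w →
      Real.sqrt (H1normSq (fun x =>
          (∫ y : EuclideanSpace ℝ (Fin 3), u y * v y / (‖x - y‖ : ℂ)) * w x)) ≤
        C * Real.sqrt (H1normSq u) * Real.sqrt (H1normSq v) * Real.sqrt (H1normSq w) := by
  refine ⟨8, by norm_num, fun u v w hu huc hv hvc hw hwc => ?_⟩
  have one_le : (1 : WithTop ℕ∞) ≤ ((⊤ : ℕ∞) : WithTop ℕ∞) := by exact_mod_cast le_top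
  replace hu := hu.of_le one_le
  replace hv := hv.of_le one_le
  replace hw := hw.of_le one_le
  have fin := hart_mul _ w (4 * √(H1normSq u) * √(H1normSq v)) (by positivity) hw hwc
    (hart_phi u v hu huc hv hvc)
  refine (Real.sqrt_le_sqrt fin).trans_eq ?_
  rw [Real.sqrt_mul (by positivity), Real.sqrt_sq (by positivity)]
  ring
end
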